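/- Let p > 2 be prime, 𝔰 the continuous square-root function of Lemma 3, and S₁(u, v) = ((u + 𝔰(v))/2, (u − 𝔰(v))/2), S₂(u, v) = ((u − 𝔰(v))/2, (u + 𝔰(v))/2). Let (u₀, v₀) ∈ ℚ_p × ℚ_p^{[2]} with |𝔰(v₀)|_p = p^{−l}, and E_k = (u₀, v₀) + (p^k ℤ_p) × (p^{k+l} ℤ_p) for k ≥ l + 1. Then for j = 1, 2 and any continuous function Φ on S_j(E_k), one has the change-of-variables identity ∫_{S_j(E_k)} Φ(x, y) dm(x, y) = ∫_{E_k} Φ(S_j(u, v)) · |𝔰(v)|_p^{−1} dm(u, v), where m is the Haar measure on ℚ_p² normalized so that m(ℤ_p²) = 1. -/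

import Mathlib

open MeasureTheory

section Aux
open Metric

lemma aux_map_isom {X : Type*} [NormedAddCommGroup X] [IsUltrametricDist X]
    [SecondCountableTopology X] [ProperSpace X] [MeasurableSpace X] [BorelSpace X]
    (m : Measure X) [m.IsAddHaarMeasure] (g : X → X) (z0 : X) (R : ℝ) (hR : 0 < R)
    (hiso : ∀ x ∈ closedBall z0 R, ∀ y ∈ closedBall z0 R, dist (g x) (g y) = dist x y)
    (hsurj : ∀ w ∈ closedBall (g z0) R, ∃ x ∈ closedBall z0 R, g x = w) :
    AEMeasurable g (m.restrict (closedBall z0 R)) ∧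
    Measure.map g (m.restrict (closedBall z0 R)) = m.restrict (closedBall (g z0) R) := by
  have hz0 : z0 ∈ closedBall z0 R := mem_closedBall_self hR.le
  have hcont : ContinuousOn g (closedBall z0 R) := by
    intro x hx
    rw [Metric.continuousWithinAt_iff]
    intro ε hε
    exact ⟨ε, hε, fun y hy h => by rw [hiso y hy x hx]; exact h⟩
  have hae : AEMeasurable g (m.restrict (closedBall z0 R)) :=
    hcont.aemeasurable measurableSet_closedBall
  refine ⟨hae, ?_⟩
  have hmaps : ∀ x ∈ closedBall z0 R, g x ∈ closedBall (g z0) R := by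
    intro x hx
    rw [mem_closedBall, hiso x hx z0 hz0]; exact hx
  have hball : ∀ (x y : X) (r : ℝ), m (closedBall x r) = m (closedBall y r) := by
    intro x y r
    rw [Measure.addHaar_closedBall_center, Measure.addHaar_closedBall_center m y]
  have hfin : IsFiniteMeasure (m.restrict (closedBall z0 R)) :=
    ⟨by rw [Measure.restrict_apply_univ]; exact measure_closedBall_lt_top⟩
  have huniv : Measure.map g (m.restrict (closedBall z0 R)) Set.univ
      = m.restrict (closedBall (g z0) R) Set.univ := by
    rw [Measure.map_apply_of_aemeasurable hae MeasurableSet.univ]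
    simp only [Set.preimage_univ, Measure.restrict_apply_univ]
    exact hball _ _ _
  have : IsFiniteMeasure (Measure.map g (m.restrict (closedBall z0 R))) := inferInstance
  have hbasis : TopologicalSpace.IsTopologicalBasis
      {S : Set X | ∃ x r, 0 < r ∧ S = closedBall x r} := by
    refine TopologicalSpace.isTopologicalBasis_of_isOpen_of_nhds ?_ ?_
    · rintro S ⟨x, r, hr, rfl⟩
      exact IsUltrametricDist.isOpen_closedBall x hr.ne'
    · intro a u ha hu
      obtain ⟨ε, hε, h⟩ := Metric.nhds_basis_closedBall.mem_iff.1 (hu.mem_nhds ha)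
      exact ⟨_, ⟨a, ε, hε, rfl⟩, mem_closedBall_self hε.le, h⟩
  have hint : ∀ (y : X) (r t : ℝ), closedBall y r ∩ closedBall y t = closedBall y (min r t) := by
    intro y r t; ext; simp
  refine ext_of_generate_finite {S : Set X | ∃ x r, 0 < r ∧ S = closedBall x r} ?_ ?_ ?_ huniv
  · rw [BorelSpace.measurable_eq (α := X)]; exact hbasis.borel_eq_generateFrom
  · rintro S ⟨x, r, hr, rfl⟩ T ⟨y, t, ht, rfl⟩ ⟨z, hz1, hz2⟩
    rw [IsUltrametricDist.closedBall_eq_of_mem hz1, IsUltrametricDist.closedBall_eq_of_mem hz2]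
    exact ⟨z, min r t, lt_min hr ht, hint _ _ _⟩
  · rintro S ⟨c, r, hr, rfl⟩
    rw [Measure.map_apply_of_aemeasurable hae measurableSet_closedBall,
      Measure.restrict_apply' measurableSet_closedBall,
      Measure.restrict_apply' measurableSet_closedBall]
    by_cases hne : (closedBall c r ∩ closedBall (g z0) R).Nonempty
    · obtain ⟨w, hw1, hw2⟩ := hne
      obtain ⟨x, hx, rfl⟩ := hsurj w hw2
      have e1 : g ⁻¹' closedBall c r ∩ closedBall z0 R = closedBall x (min r R) := by
        rw [← hint, IsUltrametricDist.closedBall_eq_of_mem hw1,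
          ← IsUltrametricDist.closedBall_eq_of_mem hx]
        ext y
        simp only [Set.mem_inter_iff, Set.mem_preimage]
        refine and_congr_left fun hy => ?_
        rw [mem_closedBall, mem_closedBall, hiso y hy x hx]
      rw [e1, IsUltrametricDist.closedBall_eq_of_mem hw1,
        IsUltrametricDist.closedBall_eq_of_mem hw2, hint]
      exact hball _ _ _
    · have h1 := Set.not_nonempty_iff_eq_empty.1 hne
      have h2 : g ⁻¹' closedBall c r ∩ closedBall z0 R = ∅ := by
        rw [← Set.not_nonempty_iff_eq_empty]
        rintro ⟨x, hx1, hx2⟩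
        exact hne ⟨g x, hx1, hmaps x hx2⟩
      rw [h1, h2]

lemma aux_ultra (p : ℕ) [Fact p.Prime] : IsUltrametricDist (ℚ_[p] × ℚ_[p]) := by
  refine ⟨fun x y z => ?_⟩
  simp only [Prod.dist_eq]
  have h1 := dist_triangle_max x.1 y.1 z.1
  have h2 := dist_triangle_max x.2 y.2 z.2
  grind

lemma aux_square (p : ℕ) [Fact p.Prime] (hp : 2 < p) (w v : ℚ_[p]) (h : ‖v - w ^ 2‖ < ‖w‖ ^ 2) :
    ∃ t : ℚ_[p], v = t ^ 2 := by
  have hw : w ≠ 0 := by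
    rintro rfl
    simp at h
    linarith [norm_nonneg v]
  have h2 : ‖(2 : ℤ_[p])‖ = 1 := by
    have : ¬ ‖((2 : ℕ) : ℤ_[p])‖ < 1 := by
      rw [PadicInt.norm_natCast_lt_one_iff]
      intro h; have := Nat.le_of_dvd (by norm_num) h; omega
    push_cast at this
    exact le_antisymm (PadicInt.norm_le_one _) (not_lt.1 this)
  have hz : ‖v / w ^ 2 - 1‖ < 1 := by
    have : v / w ^ 2 - 1 = (v - w ^ 2) / w ^ 2 := by field_simp
    rw [this, norm_div, norm_pow, div_lt_one (by positivity)]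
    exact h
  let z : ℤ_[p] := ⟨v / w ^ 2 - 1, hz.le⟩
  have hz' : ‖z‖ < 1 := hz
  obtain ⟨y, hy, -⟩ := hensels_lemma (p := p) (R := ℤ_[p])
    (F := Polynomial.X ^ 2 - Polynomial.C (1 + z)) (a := (1 : ℤ_[p])) (by
      simp [one_add_one_eq_two, h2, hz'])
  simp [sub_eq_zero] at hy
  have hy' : (y : ℚ_[p]) ^ 2 = 1 + (v / w ^ 2 - 1) := by
    rw [← PadicInt.coe_pow, hy, PadicInt.coe_add, PadicInt.coe_one]
  refine ⟨y * w, ?_⟩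
  rw [mul_pow, hy']
  field_simp
  ring

lemma aux_sub (p : ℕ) [Fact p.Prime] (a b : ℚ_[p]) : ‖a - b‖ ≤ max ‖a‖ ‖b‖ := by
  rw [sub_eq_add_neg, ← norm_neg b]; exact Padic.nonarchimedean _ _

lemma aux_norm_p_zpow (p : ℕ) [Fact p.Prime] (l : ℤ) : ‖(p : ℚ_[p]) ^ l‖ = (p : ℝ) ^ (-l) := by
  simp [zpow_neg]

lemma aux_scale_one (p : ℕ) [Fact p.Prime]
    [MeasurableSpace ℚ_[p]] [BorelSpace ℚ_[p]]
    (m : Measure (ℚ_[p] × ℚ_[p])) [m.IsAddHaarMeasure]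
    (hm : m ({x : ℚ_[p] | ‖x‖ ≤ 1} ×ˢ {x : ℚ_[p] | ‖x‖ ≤ 1}) = 1) :
    Measure.map (fun q : ℚ_[p] × ℚ_[p] => (q.1, (p : ℚ_[p]) * q.2)) m = (p : NNReal) • m := by
  have hp0 : (p : ℚ_[p]) ≠ 0 := by exact_mod_cast (Fact.out : p.Prime).ne_zero
  have hp0' : 0 < (p : ℝ) := by exact_mod_cast (Fact.out : p.Prime).pos
  let e : (ℚ_[p] × ℚ_[p]) ≃+ (ℚ_[p] × ℚ_[p]) :=
    { toFun := fun q => (q.1, (p : ℚ_[p]) * q.2)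
      invFun := fun q => (q.1, (p : ℚ_[p])⁻¹ * q.2)
      left_inv := fun q => by ext <;> simp [hp0]
      right_inv := fun q => by ext <;> simp [hp0]
      map_add' := fun q r => by ext <;> simp [mul_add] }
  have he : Continuous e := by
    change Continuous (fun q : ℚ_[p] × ℚ_[p] => (q.1, (p : ℚ_[p]) * q.2))
    fun_prop
  have he' : Continuous e.symm := by
    change Continuous (fun q : ℚ_[p] × ℚ_[p] => (q.1, (p : ℚ_[p])⁻¹ * q.2))
    fun_prop
  have hh : (Measure.map e m).IsAddHaarMeasure := e.isAddHaarMeasure_map m he he'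
  have h1 := Measure.isAddLeftInvariant_eq_smul (Measure.map e m) m
  set c := (Measure.map e m).addHaarScalarFactor m with hc
  change Measure.map e m = _
  suffices c = p by rw [h1, this]
  have hmeas : ∀ r : ℝ, MeasurableSet {x : ℚ_[p] | ‖x‖ ≤ r} := fun r =>
    (isClosed_le continuous_norm continuous_const).measurableSet
  set D : Set (ℚ_[p] × ℚ_[p]) := {x : ℚ_[p] | ‖x‖ ≤ 1} ×ˢ {x : ℚ_[p] | ‖x‖ < 1} with hD
  have hDm : MeasurableSet D := ((hmeas 1).prod
    (isOpen_lt continuous_norm continuous_const).measurableSet)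
  have h2 : Measure.map e m D = 1 := by
    rw [Measure.map_apply he.measurable hDm, ← hm]
    congr 1
    ext q
    change (‖q.1‖ ≤ 1 ∧ ‖(p : ℚ_[p]) * q.2‖ < 1) ↔ (‖q.1‖ ≤ 1 ∧ ‖q.2‖ ≤ 1)
    refine and_congr_right fun _ => ?_
    rw [norm_mul, Padic.norm_p]
    have := Padic.norm_le_pow_iff_norm_lt_pow_add_one q.2 0
    simp only [zpow_zero, zero_add, zpow_one] at this
    rw [this, inv_mul_lt_iff₀ hp0', mul_one]
  have h3 : (p : ENNReal) * m D = 1 := by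
    have hU : ({x : ℚ_[p] | ‖x‖ ≤ 1} ×ˢ {x : ℚ_[p] | ‖x‖ ≤ 1})
        = ⋃ i ∈ Finset.range p, (fun q : ℚ_[p] × ℚ_[p] => (0, -(i : ℚ_[p])) + q) ⁻¹' D := by
      ext ⟨x, y⟩
      simp only [hD, Set.mem_prod, Set.mem_ofPred_eq, Set.mem_iUnion, Set.mem_preimage,
        Finset.mem_range, Prod.mk_add_mk, zero_add, exists_prop]
      constructor
      · rintro ⟨hx, hy⟩
        obtain ⟨y', rfl⟩ : ∃ y' : ℤ_[p], (y' : ℚ_[p]) = y := ⟨⟨y, hy⟩, rfl⟩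
        obtain ⟨n, hn, hn'⟩ := PadicInt.exists_mem_range (p := p) y'
        rw [PadicInt.maximalIdeal_eq_span_p, Ideal.mem_span_singleton,
          ← PadicInt.norm_lt_one_iff_dvd, PadicInt.norm_def, PadicInt.coe_sub,
          PadicInt.coe_natCast] at hn'
        exact ⟨n, hn, hx, by rw [neg_add_eq_sub]; exact hn'⟩
      · rintro ⟨n, hn, hx, hy⟩
        refine ⟨hx, ?_⟩
        have : y = (n : ℚ_[p]) + (-(n : ℚ_[p]) + y) := by ring
        rw [this]
        refine (Padic.nonarchimedean _ _).trans (max_le ?_ hy.le)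
        simpa using Padic.norm_int_le_one (p := p) (n : ℤ)
    rw [← hm, hU, measure_biUnion_finset]
    · simp [measure_preimage_add]
    · intro i hi j hj hij
      rw [Function.onFun, Set.disjoint_left]
      rintro ⟨x, y⟩ ⟨_, h⟩ ⟨_, h'⟩
      simp only [Set.mem_ofPred_eq, Prod.mk_add_mk] at h h'
      have h4 : ‖((i - j : ℤ) : ℚ_[p])‖ < 1 := by
        have : ((i - j : ℤ) : ℚ_[p]) = (-(j : ℚ_[p]) + y) - (-(i : ℚ_[p]) + y) := by
          push_cast; ring
        rw [this]
        exact (aux_sub p _ _).trans_lt (max_lt h' h)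
      rw [Padic.norm_intCast_lt_one_iff] at h4
      simp only [Finset.coe_range, Set.mem_Iio] at hi hj
      have := Int.eq_zero_of_abs_lt_dvd h4 (by rw [abs_lt]; constructor <;> omega)
      omega
    · intro i _
      exact (by fun_prop : Measurable (fun q : ℚ_[p] × ℚ_[p] => (0, -(i : ℚ_[p])) + q)) hDm
  rw [h1, Measure.smul_apply] at h2
  have hDfin : m D ≠ ⊤ := fun h => by
    rw [h] at h3
    rw [ENNReal.mul_top (by exact_mod_cast (Fact.out : p.Prime).ne_zero)] at h3
    simp at h3
  have hD0 : m D ≠ 0 := fun h => by simp [h] at h3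
  have h5 : (c : ENNReal) * m D = p * m D := by rw [h3, ← h2]; rfl
  have := (ENNReal.mul_left_inj hD0 hDfin).1 h5
  exact_mod_cast this

lemma aux_scale (p : ℕ) [Fact p.Prime]
    [MeasurableSpace ℚ_[p]] [BorelSpace ℚ_[p]]
    (m : Measure (ℚ_[p] × ℚ_[p])) [m.IsAddHaarMeasure]
    (hm : m ({x : ℚ_[p] | ‖x‖ ≤ 1} ×ˢ {x : ℚ_[p] | ‖x‖ ≤ 1}) = 1) (l : ℤ) :
    Measure.map (fun q : ℚ_[p] × ℚ_[p] => (q.1, (p : ℚ_[p]) ^ l * q.2)) m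
      = (p : NNReal) ^ l • m := by
  have hp0 : (p : ℚ_[p]) ≠ 0 := by exact_mod_cast (Fact.out : p.Prime).ne_zero
  have hp0' : (p : NNReal) ≠ 0 := by exact_mod_cast (Fact.out : p.Prime).ne_zero
  have hme : ∀ a : ℚ_[p], Measurable (fun q : ℚ_[p] × ℚ_[p] => (q.1, a * q.2)) := fun a =>
    (by fun_prop : Continuous (fun q : ℚ_[p] × ℚ_[p] => (q.1, a * q.2))).measurable
  have h1 := aux_scale_one p m hm
  have h2 : Measure.map (fun q : ℚ_[p] × ℚ_[p] => (q.1, (p : ℚ_[p])⁻¹ * q.2)) m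
      = (p : NNReal)⁻¹ • m := by
    have h3 := congrArg (Measure.map (fun q : ℚ_[p] × ℚ_[p] => (q.1, (p : ℚ_[p])⁻¹ * q.2))) h1
    rw [Measure.map_map (hme _) (hme _), Measure.map_smul] at h3
    have h4 : ((fun q : ℚ_[p] × ℚ_[p] => (q.1, (p : ℚ_[p])⁻¹ * q.2)) ∘
      (fun q : ℚ_[p] × ℚ_[p] => (q.1, (p : ℚ_[p]) * q.2))) = id := by
      ext q <;> simp [hp0]
    rw [h4, Measure.map_id] at h3
    conv_rhs => rw [h3]
    rw [smul_smul, inv_mul_cancel₀ hp0', one_smul]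
  induction l using Int.induction_on with
  | zero => simp
  | succ i ih =>
    have h4 : (fun q : ℚ_[p] × ℚ_[p] => (q.1, (p : ℚ_[p]) ^ ((i : ℤ) + 1) * q.2)) =
      (fun q : ℚ_[p] × ℚ_[p] => (q.1, (p : ℚ_[p]) * q.2)) ∘
      (fun q : ℚ_[p] × ℚ_[p] => (q.1, (p : ℚ_[p]) ^ (i : ℤ) * q.2)) := by
      ext q
      · rfl
      · simp only [Function.comp, zpow_add₀ hp0, zpow_one]; ring
    rw [h4, ← Measure.map_map (hme _) (hme _), ih, Measure.map_smul, h1, smul_smul,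
      zpow_add₀ hp0', zpow_one]
  | pred i ih =>
    have h4 : (fun q : ℚ_[p] × ℚ_[p] => (q.1, (p : ℚ_[p]) ^ (-(i : ℤ) - 1) * q.2)) =
      (fun q : ℚ_[p] × ℚ_[p] => (q.1, (p : ℚ_[p])⁻¹ * q.2)) ∘
      (fun q : ℚ_[p] × ℚ_[p] => (q.1, (p : ℚ_[p]) ^ (-(i : ℤ)) * q.2)) := by
      ext q
      · rfl
      · simp only [Function.comp, zpow_sub₀ hp0, zpow_one]; ring
    rw [h4, ← Measure.map_map (hme _) (hme _), ih, Measure.map_smul, h2, smul_smul,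
      zpow_sub₀ hp0', zpow_one, div_eq_mul_inv]

lemma aux_norm_two (p : ℕ) [Fact p.Prime] (hp : 2 < p) : ‖(2 : ℚ_[p])‖ = 1 := by
  have : ¬ ‖((2 : ℕ) : ℚ_[p])‖ < 1 := by
    rw [Padic.norm_natCast_lt_one_iff]
    intro h; have := Nat.le_of_dvd (by norm_num) h; omega
  have h2 : ‖((2 : ℤ) : ℚ_[p])‖ ≤ 1 := Padic.norm_int_le_one (p := p) 2
  push_cast at this h2
  exact le_antisymm h2 (not_lt.1 this)

lemma aux_max (p : ℕ) [Fact p.Prime] (hp : 2 < p) (a b : ℚ_[p]) :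
    max ‖(a + b) / 2‖ ‖(a - b) / 2‖ = max ‖a‖ ‖b‖ := by
  have h2 := aux_norm_two p hp
  simp only [norm_div, h2, div_one]
  apply le_antisymm
  · exact max_le (Padic.nonarchimedean _ _) (aux_sub p _ _)
  · have ha : ‖a‖ = ‖(a + b) + (a - b)‖ := by
      rw [show (a + b) + (a - b) = 2 * a by ring, norm_mul, h2, one_mul]
    have hb : ‖b‖ = ‖(a + b) - (a - b)‖ := by
      rw [show (a + b) - (a - b) = 2 * b by ring, norm_mul, h2, one_mul]
    rw [ha, hb]
    exact max_le (Padic.nonarchimedean _ _) (aux_sub p _ _)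

lemma aux_core (p : ℕ) [Fact p.Prime] (hp : 2 < p)
    [MeasurableSpace ℚ_[p]] [BorelSpace ℚ_[p]]
    (m : Measure (ℚ_[p] × ℚ_[p])) [m.IsAddHaarMeasure]
    (hm : m ({x : ℚ_[p] | ‖x‖ ≤ 1} ×ˢ {x : ℚ_[p] | ‖x‖ ≤ 1}) = 1)
    (s : ℚ_[p] → ℚ_[p]) (u₀ v₀ : ℚ_[p]) (l k : ℤ)
    (hb : ∀ v, ‖v - v₀‖ ≤ (p : ℝ) ^ (-(k + l)) → ‖s v‖ = (p : ℝ) ^ (-l))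
    (hc : ∀ v v', ‖v - v₀‖ ≤ (p : ℝ) ^ (-(k + l)) → ‖v' - v₀‖ ≤ (p : ℝ) ^ (-(k + l)) →
      ‖s v - s v'‖ = (p : ℝ) ^ l * ‖v - v'‖)
    (hd : ∀ w, ‖w - s v₀‖ ≤ (p : ℝ) ^ (-k) →
      ∃ v, ‖v - v₀‖ ≤ (p : ℝ) ^ (-(k + l)) ∧ s v = w)
    (S : ℚ_[p] × ℚ_[p] → ℚ_[p] × ℚ_[p])
    (hS : S = fun q => ((q.1 + s q.2) / 2, (q.1 - s q.2) / 2))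
    (Ek : Set (ℚ_[p] × ℚ_[p]))
    (hEk : Ek = {q : ℚ_[p] × ℚ_[p] |
      ‖q.1 - u₀‖ ≤ (p : ℝ) ^ (-k) ∧ ‖q.2 - v₀‖ ≤ (p : ℝ) ^ (-(k + l))})
    (Φ : ℚ_[p] × ℚ_[p] → ℝ) (hΦ : ContinuousOn Φ (S '' Ek)) :
    ∫ q in S '' Ek, Φ q ∂m = ∫ q in Ek, Φ (S q) * ‖s q.2‖⁻¹ ∂m := by
  have hp0 : (p : ℚ_[p]) ≠ 0 := by exact_mod_cast (Fact.out : p.Prime).ne_zero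
  have hp0' : 0 < (p : ℝ) := by exact_mod_cast (Fact.out : p.Prime).pos
  have hpl0 : (p : ℚ_[p]) ^ l ≠ 0 := zpow_ne_zero _ hp0
  have := aux_ultra p
  have h2 := aux_norm_two p hp
  have h20 : (2 : ℚ_[p]) ≠ 0 := by intro h; simp [h] at h2
  let A : (ℚ_[p] × ℚ_[p]) ≃ₜ (ℚ_[p] × ℚ_[p]) :=
    { toFun := fun q => (q.1, (p : ℚ_[p]) ^ l * q.2)
      invFun := fun q => (q.1, ((p : ℚ_[p]) ^ l)⁻¹ * q.2)
      left_inv := fun q => by ext <;> simp [mul_inv_cancel_left₀ hpl0, inv_mul_cancel_left₀ hpl0]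
      right_inv := fun q => by ext <;> simp [mul_inv_cancel_left₀ hpl0, inv_mul_cancel_left₀ hpl0]
      continuous_toFun := by fun_prop
      continuous_invFun := by fun_prop }
  have hA : ∀ q, A q = (q.1, (p : ℚ_[p]) ^ l * q.2) := fun q => rfl
  have hAm : Measure.map A m = (p : NNReal) ^ l • m := aux_scale p m hm l
  set z0 : ℚ_[p] × ℚ_[p] := (u₀, ((p : ℚ_[p]) ^ l)⁻¹ * v₀) with hz0
  set R : ℝ := (p : ℝ) ^ (-k) with hR
  have hRpos : 0 < R := zpow_pos hp0' _
  have hAz : A z0 = (u₀, v₀) := by simp [hA, hz0, mul_inv_cancel_left₀ hpl0]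
  have hpl : ∀ y : ℚ_[p], ‖(p : ℚ_[p]) ^ l * y‖ = (p : ℝ) ^ (-l) * ‖y‖ := fun y => by
    rw [norm_mul, aux_norm_p_zpow]
  have hEk' : ∀ q, q ∈ Ek ↔ ‖q.1 - u₀‖ ≤ R ∧ ‖q.2 - v₀‖ ≤ (p : ℝ) ^ (-(k + l)) := by
    intro q; rw [hEk]; rfl
  have hAB : A ⁻¹' Ek = closedBall z0 R := by
    ext q
    rw [Set.mem_preimage, hEk', mem_closedBall, Prod.dist_eq, max_le_iff, hA, dist_eq_norm,
      dist_eq_norm]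
    refine and_congr_right fun _ => ?_
    have : (p : ℚ_[p]) ^ l * q.2 - v₀ = (p : ℚ_[p]) ^ l * (q.2 - z0.2) := by
      simp [hz0, mul_sub, mul_inv_cancel_left₀ hpl0]
    simp only
    rw [this, hpl, neg_add, add_comm, zpow_add₀ hp0'.ne',
      mul_le_mul_iff_right₀ (zpow_pos hp0' _)]
  have hABm : ∀ q, q ∈ closedBall z0 R ↔ A q ∈ Ek := fun q => by rw [← hAB]; rfl
  let g : ℚ_[p] × ℚ_[p] → ℚ_[p] × ℚ_[p] := fun q => S (A q)
  have hSd : ∀ q r, dist (S q) (S r) = max ‖q.1 - r.1‖ ‖s q.2 - s r.2‖ := by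
    intro q r
    rw [Prod.dist_eq, hS, dist_eq_norm, dist_eq_norm, ← aux_max p hp (q.1 - r.1) (s q.2 - s r.2)]
    simp only
    congr 1
    · congr 1; ring
    · congr 1; ring
  have hiso : ∀ x ∈ closedBall z0 R, ∀ y ∈ closedBall z0 R, dist (g x) (g y) = dist x y := by
    intro x hx y hy
    rw [hABm, hEk'] at hx hy
    rw [hSd, hc _ _ hx.2 hy.2, Prod.dist_eq, dist_eq_norm, dist_eq_norm]
    simp only [hA]
    rw [← mul_sub, hpl, ← mul_assoc, ← zpow_add₀ hp0'.ne']
    simp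
  have hgz : g z0 = ((u₀ + s v₀) / 2, (u₀ - s v₀) / 2) := by
    change S (A z0) = _
    rw [hAz, hS]
  have hsurj : ∀ w ∈ closedBall (g z0) R, ∃ x ∈ closedBall z0 R, g x = w := by
    rintro ⟨x, y⟩ hw
    rw [hgz, mem_closedBall, Prod.dist_eq, max_le_iff, dist_eq_norm, dist_eq_norm] at hw
    simp only at hw
    obtain ⟨v, hv, hv'⟩ := hd (x - y) (by
      have : x - y - s v₀ = (x - (u₀ + s v₀) / 2) - (y - (u₀ - s v₀) / 2) := by
        field_simp; ring
      rw [this]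
      exact (aux_sub p _ _).trans (max_le hw.1 hw.2))
    have hu : ‖x + y - u₀‖ ≤ R := by
      have : x + y - u₀ = (x - (u₀ + s v₀) / 2) + (y - (u₀ - s v₀) / 2) := by
        field_simp; ring
      rw [this]
      exact (Padic.nonarchimedean _ _).trans (max_le hw.1 hw.2)
    refine ⟨A.symm (x + y, v), ?_, ?_⟩
    · rw [hABm, A.apply_symm_apply, hEk']
      exact ⟨hu, hv⟩
    · change S (A (A.symm (x + y, v))) = _
      rw [A.apply_symm_apply, hS]
      ext
      · simp only [hv']; field_simp; ring
      · simp only [hv']; field_simp; ring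
  obtain ⟨hae, hmap⟩ := aux_map_isom m g z0 R hRpos hiso hsurj
  have himg : S '' Ek = closedBall (g z0) R := by
    ext w
    constructor
    · rintro ⟨q, hq, rfl⟩
      have h1 : A.symm q ∈ closedBall z0 R := by rw [hABm, A.apply_symm_apply]; exact hq
      have h3 := hiso _ h1 z0 (mem_closedBall_self hRpos.le)
      have h4 : g (A.symm q) = S q := by
        change S (A (A.symm q)) = _
        rw [A.apply_symm_apply]
      rw [mem_closedBall, ← h4, h3]; exact h1
    · intro hw
      obtain ⟨x, hx, rfl⟩ := hsurj w hw
      exact ⟨A x, (hABm x).1 hx, rfl⟩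
  have hEm : MeasurableSet Ek := by
    have : Ek = A.symm ⁻¹' closedBall z0 R := by
      rw [← hAB, ← Set.preimage_comp]; simp
    rw [this]
    exact A.symm.continuous.measurable measurableSet_closedBall
  have e1 : ∫ q in S '' Ek, Φ q ∂m = ∫ q in closedBall z0 R, Φ (S (A q)) ∂m := by
    rw [himg] at hΦ ⊢
    rw [← hmap, integral_map hae]
    rw [hmap]
    exact hΦ.aestronglyMeasurable measurableSet_closedBall
  have e2 : ∫ q in closedBall z0 R, Φ (S (A q)) ∂m = ∫ q in Ek, Φ (S q) ∂(Measure.map A m) := by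
    rw [A.measurableEmbedding.setIntegral_map, hAB]
  have e3 : ∫ q in Ek, Φ (S q) * ‖s q.2‖⁻¹ ∂m = ∫ q in Ek, Φ (S q) * (p : ℝ) ^ l ∂m := by
    refine setIntegral_congr_fun hEm fun q hq => ?_
    change Φ (S q) * ‖s q.2‖⁻¹ = Φ (S q) * (p : ℝ) ^ l
    rw [hb _ ((hEk' q).1 hq).2, zpow_neg, inv_inv]
  rw [e1, e2, e3, hAm, Measure.restrict_smul, integral_smul_nnreal_measure, integral_mul_const,
    mul_comm, NNReal.smul_def, smul_eq_mul]
  push_cast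
  rfl

end Aux

/-- Lemma 5 (iii): let `p > 2` be prime, `𝔰` the continuous square-root function of Lemma 3,
`S₁(u, v) = ((u + 𝔰(v))/2, (u - 𝔰(v))/2)`, `S₂(u, v) = ((u - 𝔰(v))/2, (u + 𝔰(v))/2)`,
`(u₀, v₀) ∈ ℚ_p × ℚ_p^{[2]}` with `|𝔰(v₀)|_p = p^{-l}`, and
`E_k = (u₀, v₀) + (p^k ℤ_p) × (p^{k+l} ℤ_p)` with `k ≥ l + 1`. Then for `j = 1, 2` and any
continuous function `Φ` on `S_j(E_k)`,
`∫_{S_j(E_k)} Φ(x, y) dm(x, y) = ∫_{E_k} Φ(S_j(u, v))·|𝔰(v)|_p⁻¹ dm(u, v)`, where `m` is the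
Haar measure on `ℚ_p²` normalized so that `m(ℤ_p × ℤ_p) = 1`. -/
theorem change_of_variables_S1_S2 (p : ℕ) [Fact p.Prime] (hp : 2 < p)
    [MeasurableSpace ℚ_[p]] [BorelSpace ℚ_[p]]
    (m : Measure (ℚ_[p] × ℚ_[p])) [m.IsAddHaarMeasure]
    (hm : m ({x : ℚ_[p] | ‖x‖ ≤ 1} ×ˢ {x : ℚ_[p] | ‖x‖ ≤ 1}) = 1)
    (s : ℚ_[p] → ℚ_[p])
    (hs_cont : ContinuousOn s {x : ℚ_[p] | ∃ t : ℚ_[p], x = t ^ 2})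
    (hs_sq : ∀ x : ℚ_[p], (∃ t : ℚ_[p], x = t ^ 2) → (s x) ^ 2 = x)
    (hs_scale : ∀ (l : ℤ) (c : ℚ_[p]), ‖c‖ = 1 → (∃ t : ℚ_[p], c = t ^ 2) →
      s ((p : ℚ_[p]) ^ (2 * l) * c) = (p : ℚ_[p]) ^ l * s c)
    (hs_coset : ∀ c v : ℚ_[p], ‖c‖ = 1 → (∃ t : ℚ_[p], c = t ^ 2) →
      (∃ t : ℚ_[p], v = t ^ 2) → ‖v - c‖ ≤ (p : ℝ)⁻¹ → ‖s v - s c‖ ≤ (p : ℝ)⁻¹)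
    (u₀ v₀ : ℚ_[p]) (hv₀ : ∃ t : ℚ_[p], v₀ = t ^ 2)
    (l : ℤ) (hl : ‖s v₀‖ = (p : ℝ) ^ (-l))
    (k : ℤ) (hk : l + 1 ≤ k)
    (S₁ S₂ : ℚ_[p] × ℚ_[p] → ℚ_[p] × ℚ_[p])
    (hS₁ : S₁ = fun q => ((q.1 + s q.2) / 2, (q.1 - s q.2) / 2))
    (hS₂ : S₂ = fun q => ((q.1 - s q.2) / 2, (q.1 + s q.2) / 2))
    (Ek : Set (ℚ_[p] × ℚ_[p]))
    (hEk : Ek = {q : ℚ_[p] × ℚ_[p] |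
      ‖q.1 - u₀‖ ≤ (p : ℝ) ^ (-k) ∧ ‖q.2 - v₀‖ ≤ (p : ℝ) ^ (-(k + l))}) :
    (∀ Φ : ℚ_[p] × ℚ_[p] → ℝ, ContinuousOn Φ (S₁ '' Ek) →
        ∫ q in S₁ '' Ek, Φ q ∂m = ∫ q in Ek, Φ (S₁ q) * ‖s q.2‖⁻¹ ∂m) ∧
      (∀ Φ : ℚ_[p] × ℚ_[p] → ℝ, ContinuousOn Φ (S₂ '' Ek) →
        ∫ q in S₂ '' Ek, Φ q ∂m = ∫ q in Ek, Φ (S₂ q) * ‖s q.2‖⁻¹ ∂m) := by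
  have hp0 : (p : ℚ_[p]) ≠ 0 := by exact_mod_cast (Fact.out : p.Prime).ne_zero
  have hp1 : 1 < (p : ℝ) := by exact_mod_cast (Fact.out : p.Prime).one_lt
  have hp0' : 0 < (p : ℝ) := by linarith
  have h2 := aux_norm_two p hp
  have hw0 := hs_sq v₀ hv₀
  have hlpos : 0 < (p : ℝ) ^ (-l) := zpow_pos hp0' _
  have hlt : (p : ℝ) ^ (-l - 1) < (p : ℝ) ^ (-l) := zpow_lt_zpow_right₀ hp1 (by omega)
  have hkl : (p : ℝ) ^ (-k) ≤ (p : ℝ) ^ (-l - 1) := zpow_le_zpow_right₀ hp1.le (by omega)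
  have hnv0 : ‖v₀‖ = (p : ℝ) ^ (-(2 * l)) := by
    rw [← hw0, norm_pow, hl, ← zpow_natCast, ← zpow_mul]
    congr 1; push_cast; ring
  have hball : ∀ v, ‖v - v₀‖ ≤ (p : ℝ) ^ (-(k + l)) → ‖v - v₀‖ ≤ (p : ℝ) ^ (-(2 * l) - 1) :=
    fun v hv => hv.trans (zpow_le_zpow_right₀ hp1.le (by omega))
  have hball' : ∀ v, ‖v - v₀‖ ≤ (p : ℝ) ^ (-(k + l)) → ‖v - v₀‖ < (p : ℝ) ^ (-(2 * l)) :=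
    fun v hv => (hball v hv).trans_lt (zpow_lt_zpow_right₀ hp1 (by omega))
  -- elements of the ball are squares
  have hsq : ∀ v, ‖v - v₀‖ ≤ (p : ℝ) ^ (-(k + l)) → ∃ t : ℚ_[p], v = t ^ 2 := by
    intro v hv
    refine aux_square p hp (s v₀) v ?_
    rw [← norm_pow, hw0, hnv0]
    exact hball' v hv
  have hnv : ∀ v, ‖v - v₀‖ ≤ (p : ℝ) ^ (-(k + l)) → ‖v‖ = (p : ℝ) ^ (-(2 * l)) := by
    intro v hv
    rw [← hnv0]
    have h3 : ‖v - v₀‖ < ‖v₀‖ := by rw [hnv0]; exact hball' v hv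
    have h4 := IsUltrametricDist.norm_add_eq_max_of_norm_ne_norm (x := v - v₀) (y := v₀) h3.ne
    rw [sub_add_cancel, max_eq_right h3.le] at h4
    exact h4
  have hunit : ∀ v, ‖v‖ = (p : ℝ) ^ (-(2 * l)) → ‖(p : ℚ_[p]) ^ (-(2 * l)) * v‖ = 1 := by
    intro v hv
    rw [norm_mul, aux_norm_p_zpow, hv, ← zpow_add₀ hp0'.ne']
    simp
  have hcsq : ∀ v : ℚ_[p], (∃ t : ℚ_[p], v = t ^ 2) →
      ∃ t : ℚ_[p], (p : ℚ_[p]) ^ (-(2 * l)) * v = t ^ 2 := by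
    rintro v ⟨t, rfl⟩
    refine ⟨(p : ℚ_[p]) ^ (-l) * t, ?_⟩
    rw [mul_pow, ← zpow_natCast ((p : ℚ_[p]) ^ (-l)), ← zpow_mul]
    congr 2; push_cast; ring
  have hsc : ∀ v : ℚ_[p], ‖v‖ = (p : ℝ) ^ (-(2 * l)) → (∃ t : ℚ_[p], v = t ^ 2) →
      s v = (p : ℚ_[p]) ^ l * s ((p : ℚ_[p]) ^ (-(2 * l)) * v) := by
    intro v hv hv'
    rw [← hs_scale l _ (hunit v hv) (hcsq v hv'), ← mul_assoc, ← zpow_add₀ hp0]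
    simp
  have hnear : ∀ v, ‖v - v₀‖ ≤ (p : ℝ) ^ (-(k + l)) → ‖s v - s v₀‖ ≤ (p : ℝ) ^ (-l - 1) := by
    intro v hv
    rw [hsc v (hnv v hv) (hsq v hv), hsc v₀ hnv0 hv₀, ← mul_sub, norm_mul, aux_norm_p_zpow,
      zpow_sub₀ hp0'.ne', zpow_one, div_eq_mul_inv]
    refine mul_le_mul_of_nonneg_left ?_ hlpos.le
    refine hs_coset _ _ (hunit _ hnv0) (hcsq _ hv₀) (hcsq _ (hsq v hv)) ?_
    rw [← mul_sub, norm_mul, aux_norm_p_zpow]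
    refine (mul_le_mul_of_nonneg_left (hball v hv) (zpow_pos hp0' _).le).trans ?_
    rw [← zpow_add₀ hp0'.ne', ← zpow_neg_one]
    exact (congrArg (fun n : ℤ => (p : ℝ) ^ n) (by ring)).le
  have hnorm : ∀ w, ‖w - s v₀‖ ≤ (p : ℝ) ^ (-l - 1) → ‖w‖ = (p : ℝ) ^ (-l) := by
    intro w hw
    have h3 : ‖w - s v₀‖ < ‖s v₀‖ := by rw [hl]; exact hw.trans_lt hlt
    have h4 := IsUltrametricDist.norm_add_eq_max_of_norm_ne_norm (x := w - s v₀) (y := s v₀) h3.ne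
    rw [sub_add_cancel, max_eq_right h3.le, hl] at h4
    exact h4
  have hsum : ∀ w w', ‖w - s v₀‖ ≤ (p : ℝ) ^ (-l - 1) → ‖w' - s v₀‖ ≤ (p : ℝ) ^ (-l - 1) →
      ‖w + w'‖ = (p : ℝ) ^ (-l) := by
    intro w w' hw hw'
    have h3 : ‖w' - w‖ < ‖2 * w‖ := by
      rw [norm_mul, h2, one_mul, hnorm w hw]
      have : w' - w = (w' - s v₀) - (w - s v₀) := by ring
      rw [this]
      exact ((aux_sub p _ _).trans (max_le hw' hw)).trans_lt hlt
    have h4 := IsUltrametricDist.norm_add_eq_max_of_norm_ne_norm (x := w' - w) (y := 2 * w) h3.ne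
    rw [max_eq_right h3.le, norm_mul, h2, one_mul, hnorm w hw] at h4
    rw [← h4]; congr 1; ring
  have hb : ∀ v, ‖v - v₀‖ ≤ (p : ℝ) ^ (-(k + l)) → ‖s v‖ = (p : ℝ) ^ (-l) :=
    fun v hv => hnorm _ (hnear v hv)
  have hc : ∀ v v', ‖v - v₀‖ ≤ (p : ℝ) ^ (-(k + l)) → ‖v' - v₀‖ ≤ (p : ℝ) ^ (-(k + l)) →
      ‖s v - s v'‖ = (p : ℝ) ^ l * ‖v - v'‖ := by
    intro v v' hv hv'
    have h3 : v - v' = (s v - s v') * (s v + s v') := by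
      have a1 := hs_sq v (hsq v hv)
      have a2 := hs_sq v' (hsq v' hv')
      linear_combination a2 - a1
    rw [h3, norm_mul, hsum _ _ (hnear v hv) (hnear v' hv'), mul_comm, mul_assoc,
      ← zpow_add₀ hp0'.ne']
    simp
  have hd : ∀ w, ‖w - s v₀‖ ≤ (p : ℝ) ^ (-k) →
      ∃ v, ‖v - v₀‖ ≤ (p : ℝ) ^ (-(k + l)) ∧ s v = w := by
    intro w hw
    have hw' := hw.trans hkl
    have h3 : ‖w ^ 2 - v₀‖ ≤ (p : ℝ) ^ (-(k + l)) := by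
      have : w ^ 2 - v₀ = (w - s v₀) * (w + s v₀) := by linear_combination hw0
      rw [this, norm_mul, hsum w (s v₀) hw' (by rw [sub_self, norm_zero]; positivity),
        neg_add, zpow_add₀ hp0'.ne']
      exact mul_le_mul_of_nonneg_right hw hlpos.le
    refine ⟨w ^ 2, h3, ?_⟩
    have h4 := hs_sq (w ^ 2) ⟨w, rfl⟩
    have h5 := hsum _ _ (hnear _ h3) hw'
    have h6 : s (w ^ 2) + w ≠ 0 := by
      intro h; rw [h, norm_zero] at h5; exact hlpos.ne h5
    have h7 : (s (w ^ 2) - w) * (s (w ^ 2) + w) = 0 := by linear_combination h4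
    exact sub_eq_zero.1 ((mul_eq_zero.1 h7).resolve_right h6)
  refine ⟨fun Φ hΦ => aux_core p hp m hm s u₀ v₀ l k hb hc hd S₁ hS₁ Ek hEk Φ hΦ,
    fun Φ hΦ => ?_⟩
  have := aux_core p hp m hm (fun v => - s v) u₀ v₀ l k
    (fun v hv => by rw [norm_neg]; exact hb v hv)
    (fun v v' hv hv' => by
      rw [← hc v v' hv hv', ← norm_neg]; congr 1; ring)
    (fun w hw => by
      obtain ⟨v, hv, hv'⟩ := hd (-w) (by
        have h8 : -w - s v₀ = -(w - -s v₀) := by ring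
        rw [h8, norm_neg]; exact hw)
      exact ⟨v, hv, by rw [hv', neg_neg]⟩)
    S₂ (by rw [hS₂]; ext q <;> simp [sub_eq_add_neg]) Ek hEk Φ hΦ
  simpa only [norm_neg] using this
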